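/- For every n ≥ 1 and m ≥ 0, there is a bijection between the set PT(n,m) of rooted planar trees with n+1 leaves and m internal nodes in which every internal node has at least two children, and the set SP⁺(n,m) of Schröder paths of semilength n with exactly n−m diagonal steps having no diagonal step lying on the diagonal. -/

import Mathlib

/-! Schröder paths -/

inductive SStep : Type
  | H | V | D
deriving DecidableEq

def SStep.dx : SStep → ℕ
  | .H => 1 | .V => 0 | .D => 1

def SStep.dy : SStep → ℕ
  | .H => 0 | .V => 1 | .D => 1

def pathX (p : List SStep) : ℕ := (p.map SStep.dx).sum
def pathY (p : List SStep) : ℕ := (p.map SStep.dy).sum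

/-- A Schröder path of semilength `n`: from (0,0) to (n,n), steps H,V,D,
never rising above the diagonal. -/
def IsSchroder (n : ℕ) (p : List SStep) : Prop :=
  pathX p = n ∧ pathY p = n ∧ ∀ q : List SStep, q <+: p → pathY q ≤ pathX q

/-- No diagonal step starts on the diagonal. -/
def DiagFree (p : List SStep) : Prop :=
  ∀ q r : List SStep, p = q ++ SStep.D :: r → pathX q ≠ pathY q

/-- Every diagonal step is immediately followed by a horizontal step,
except if it is the last step. -/
def DFollowedByH (p : List SStep) : Prop :=
  ∀ q r : List SStep, p = q ++ SStep.D :: r → r = [] ∨ ∃ r' : List SStep, r = SStep.H :: r'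

def SP (n m : ℕ) : Type := {p : List SStep // IsSchroder n p ∧ p.count SStep.D + m = n}
def SPplus (n m : ℕ) : Type :=
  {p : List SStep // IsSchroder n p ∧ p.count SStep.D + m = n ∧ DiagFree p}
def SPzero (n m : ℕ) : Type :=
  {p : List SStep // IsSchroder n p ∧ p.count SStep.D + m = n ∧ ¬ DiagFree p}
def RP (n m : ℕ) : Type :=
  {p : List SStep // IsSchroder n p ∧ p.count SStep.D + m = n ∧ DFollowedByH p}

/-! Rooted planar trees -/

inductive PTree : Type
  | node : List PTree → PTree

namespace PTree

def leaves : PTree → ℕ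
  | node [] => 1
  | node (c :: cs) => ((c :: cs).attach.map fun x => leaves x.1).sum
decreasing_by
  have := List.sizeOf_lt_of_mem x.2
  simp only [PTree.node.sizeOf_spec, List.cons.sizeOf_spec] at this ⊢
  omega

def internal : PTree → ℕ
  | node [] => 0
  | node (c :: cs) => 1 + ((c :: cs).attach.map fun x => internal x.1).sum
decreasing_by
  have := List.sizeOf_lt_of_mem x.2
  simp only [PTree.node.sizeOf_spec, List.cons.sizeOf_spec] at this ⊢
  omega

def Good : PTree → Prop
  | node cs => cs.length ≠ 1 ∧ ∀ c ∈ cs.attach, Good c.1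
decreasing_by
  have := List.sizeOf_lt_of_mem c.2
  simp only [PTree.node.sizeOf_spec] at this ⊢
  omega

end PTree

def PT (n m : ℕ) : Type :=
  {t : PTree // t.Good ∧ t.leaves = n + 1 ∧ t.internal = m}

def PTn (n : ℕ) : Type := {t : PTree // t.Good ∧ t.leaves = n + 1}

/-! Motzkin paths -/

inductive MStep : Type
  | U | H | D
deriving DecidableEq

def MStep.dh : MStep → ℤ
  | .U => 1 | .H => 0 | .D => -1

def mHeight (p : List MStep) : ℤ := (p.map MStep.dh).sum

def IsMotzkin (k : ℕ) (p : List MStep) : Prop :=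
  p.length = k ∧ mHeight p = 0 ∧ ∀ q : List MStep, q <+: p → 0 ≤ mHeight q

def HFollowedByU (p : List MStep) : Prop :=
  ∀ q r : List MStep, p = q ++ MStep.H :: r → r = [] ∨ ∃ r' : List MStep, r = MStep.U :: r'

def MP (k : ℕ) : Type := {p : List MStep // IsMotzkin k p}
def RMP (k : ℕ) : Type := {p : List MStep // IsMotzkin k p ∧ HFollowedByU p}

/-- Motzkin steps with two possible colors on up and horizontal steps. -/
inductive CMStep : Type
  | U : Bool → CMStep
  | H : Bool → CMStep
  | D : CMStep
deriving DecidableEq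

def CMStep.forget : CMStep → MStep
  | .U _ => .U | .H _ => .H | .D => .D

/-- (h,u)-colored Motzkin paths of length n-1. -/
def huMP (n : ℕ) : Type := {p : List CMStep // IsMotzkin (n - 1) (p.map CMStep.forget)}


namespace PTree

theorem leaves_cons (c : PTree) (cs : List PTree) :
    (node (c :: cs)).leaves = c.leaves + (cs.map leaves).sum := by
  rw [leaves, List.attach_map_val (f := leaves), List.map_cons, List.sum_cons]

theorem internal_cons (c : PTree) (cs : List PTree) :
    (node (c :: cs)).internal = 1 + (c.internal + (cs.map internal).sum) := by
  rw [internal, List.attach_map_val (f := internal), List.map_cons, List.sum_cons]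

theorem good_node (cs : List PTree) :
    (node cs).Good ↔ cs.length ≠ 1 ∧ ∀ c ∈ cs, c.Good := by
  rw [Good]
  simp

/-- Induction over planar trees without unary nodes. -/
theorem Good.induction {P : PTree → Prop} (leaf : P (node []))
    (branch : ∀ a b cs, P a → P b → (∀ c ∈ cs, P c) → P (node (a :: b :: cs))) :
    ∀ t : PTree, t.Good → P t
  | node [], _ => leaf
  | node [a], h => absurd rfl ((good_node [a]).1 h).1
  | node (a :: b :: cs), h =>
    have hg := ((good_node _).1 h).2
    branch a b cs (Good.induction leaf branch a (hg a (by simp)))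
      (Good.induction leaf branch b (hg b (by simp)))
      (fun c hc => Good.induction leaf branch c (hg c (by simp [hc])))
termination_by t => sizeOf t
decreasing_by
  · simp
    omega
  · simp
    omega
  · have := List.sizeOf_lt_of_mem hc
    simp
    omega

mutual

/-- The path `H φ(c₁) D φ(c₂) D ⋯ D φ(cₖ) V φ(c₀)` of a tree with root subtrees `c₀, …, cₖ`. -/
def toPath : PTree → List SStep
  | node [] => []
  | node [_] => []
  | node (a :: b :: cs) => .H :: (toPath b ++ (diagPath cs ++ .V :: toPath a))

/-- The concatenation of the paths of the given trees, each preceded by a diagonal step. -/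
def diagPath : List PTree → List SStep
  | [] => []
  | c :: cs => .D :: (toPath c ++ diagPath cs)

end

end PTree

open PTree

theorem pathX_append (p q : List SStep) : pathX (p ++ q) = pathX p + pathX q := by
  simp [pathX]

theorem pathY_append (p q : List SStep) : pathY (p ++ q) = pathY p + pathY q := by
  simp [pathY]

theorem pathX_cons (s : SStep) (p : List SStep) : pathX (s :: p) = s.dx + pathX p := by
  simp [pathX]

theorem pathY_cons (s : SStep) (p : List SStep) : pathY (s :: p) = s.dy + pathY p := by
  simp [pathY]

theorem pathX_nil : pathX [] = 0 := rfl

theorem pathY_nil : pathY [] = 0 := rfl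

namespace PTree

theorem leaves_toPath (t : PTree) (ht : t.Good) :
    t.leaves = pathX t.toPath + 1 ∧ t.leaves = pathY t.toPath + 1 ∧
      t.leaves = t.toPath.count .D + t.internal + 1 := by
  revert t
  refine Good.induction ?_ ?_
  · simp [leaves, internal, toPath, pathX, pathY]
  · intro a b cs ha hb hcs
    have key : (cs.map leaves).sum = pathX (diagPath cs) ∧
        (cs.map leaves).sum = pathY (diagPath cs) ∧
        (cs.map leaves).sum = (diagPath cs).count .D + (cs.map internal).sum := by
      clear ha hb
      induction cs with
      | nil => simp [diagPath, pathX, pathY]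
      | cons c cs ih =>
        have h := hcs c (by simp)
        have h' := ih fun c hc => hcs c (by simp [hc])
        simp only [diagPath, List.map_cons, List.sum_cons, pathX_cons, pathX_append, pathY_cons,
          pathY_append, SStep.dx, SStep.dy, List.count_cons_self, List.count_append]
        omega
    simp only [leaves_cons, internal_cons, toPath, List.map_cons, List.sum_cons, pathX_cons,
      pathX_append, pathY_cons, pathY_append, SStep.dx, SStep.dy, List.count_cons,
      List.count_append, beq_iff_eq, reduceCtorEq, if_false]
    omega

theorem pathX_toPath (t : PTree) (ht : t.Good) : pathX t.toPath = pathY t.toPath := by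
  have := leaves_toPath t ht
  omega

theorem pathX_diagPath (cs : List PTree) (hcs : ∀ c ∈ cs, c.Good) :
    pathX (diagPath cs) = pathY (diagPath cs) := by
  induction cs with
  | nil => rfl
  | cons c cs ih =>
    have h := pathX_toPath c (hcs c (by simp))
    have h' := ih fun c hc => hcs c (by simp [hc])
    simp only [diagPath, pathX_cons, pathX_append, pathY_cons, pathY_append, SStep.dx, SStep.dy]
    omega

end PTree

/-- A path started at height `h` stays weakly below the diagonal and has no diagonal step on it. -/
def StaysBelow : ℕ → List SStep → Prop
  | _, [] => True
  | h, .H :: p => StaysBelow (h + 1) p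
  | 0, .V :: _ => False
  | h + 1, .V :: p => StaysBelow h p
  | 0, .D :: _ => False
  | h + 1, .D :: p => StaysBelow (h + 1) p

theorem StaysBelow.pathY_le {h : ℕ} {p : List SStep} (hp : StaysBelow h p) :
    ∀ q, q <+: p → pathY q ≤ h + pathX q := by
  fun_induction StaysBelow h p <;> intro q hq <;> rcases q with _ | ⟨s, q⟩ <;>
    simp_all [pathX_cons, pathY_cons, pathX_nil, pathY_nil, SStep.dx, SStep.dy]
  all_goals
    rename_i ih
    have := ih _ hq.2
    omega

theorem StaysBelow.pathY_lt {h : ℕ} {p : List SStep} (hp : StaysBelow h p) :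
    ∀ q, q ++ [.D] <+: p → pathY q < h + pathX q := by
  fun_induction StaysBelow h p <;> intro q hq <;> rcases q with _ | ⟨s, q⟩ <;>
    simp_all [pathX_cons, pathY_cons, pathX_nil, pathY_nil, SStep.dx, SStep.dy]
  all_goals
    rename_i ih
    have := ih _ hq.2
    omega

namespace PTree

theorem staysBelow_toPath_append (t : PTree) (ht : t.Good) :
    ∀ h r, StaysBelow h r → StaysBelow h (t.toPath ++ r) := by
  revert t
  refine Good.induction ?_ ?_
  · simp [toPath]
  · intro a b cs ha hb hcs h r hr
    have key : ∀ s, StaysBelow (h + 1) s → StaysBelow (h + 1) (diagPath cs ++ s) := by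
      clear ha hb
      induction cs with
      | nil => simp [diagPath]
      | cons c cs ih =>
        intro s hs
        simpa [diagPath, StaysBelow] using
          hcs c (by simp) _ _ (ih (fun c hc => hcs c (by simp [hc])) s hs)
    simpa [toPath, StaysBelow] using hb _ _ (key _ (by simpa [StaysBelow] using ha _ _ hr))

theorem staysBelow_toPath (t : PTree) (ht : t.Good) : StaysBelow 0 t.toPath := by
  simpa using staysBelow_toPath_append t ht 0 [] trivial

theorem toPath_append_inj (t : PTree) (ht : t.Good) :
    ∀ t' : PTree, t'.Good → ∀ r r' : List SStep, r.head? ≠ some .H → r'.head? ≠ some .H →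
      t.toPath ++ r = t'.toPath ++ r' → t = t' ∧ r = r' := by
  revert t
  refine Good.induction ?_ ?_
  · intro t' ht' r r' hr hr' h
    match t', ht' with
    | node [], _ => exact ⟨rfl, by simpa [toPath] using h⟩
    | node [a], h' => exact absurd rfl ((good_node [a]).1 h').1
    | node (a :: b :: cs), _ => simp_all [toPath]
  · intro a b cs ha hb hcs t' ht' r r' hr hr' h
    match t', ht' with
    | node [], _ =>
      simp only [toPath, List.nil_append] at h
      simp [← h] at hr'
    | node [a], h' => exact absurd rfl ((good_node [a]).1 h').1
    | node (a' :: b' :: cs'), h' =>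
      have hg := ((good_node _).1 h').2
      have key : ∀ (cs' : List PTree), (∀ c ∈ cs', c.Good) → ∀ s s' : List SStep,
          diagPath cs ++ .V :: s = diagPath cs' ++ .V :: s' → cs = cs' ∧ s = s' := by
        clear ha hb h
        induction cs with
        | nil =>
          rintro (_ | ⟨c', cs'⟩) _ s s' h
          · simpa [diagPath] using h
          · simp [diagPath] at h
        | cons c cs ih =>
          rintro (_ | ⟨c', cs'⟩) hg' s s' h
          · simp [diagPath] at h
          · simp only [diagPath, List.cons_append, List.append_assoc, List.cons.injEq,
              true_and] at h
            obtain ⟨rfl, h₁⟩ := hcs c (by simp) c' (hg' _ (by simp)) _ _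
              (by cases cs <;> simp [diagPath]) (by cases cs' <;> simp [diagPath]) h
            obtain ⟨rfl, rfl⟩ := ih (fun c hc => hcs c (by simp [hc])) cs'
              (fun c hc => hg' c (by simp [hc])) s s' h₁
            exact ⟨rfl, rfl⟩
      simp only [toPath, List.cons_append, List.append_assoc, List.cons.injEq, true_and] at h
      obtain ⟨rfl, h₁⟩ := hb b' (hg _ (by simp)) _ _
        (by cases cs <;> simp [diagPath]) (by cases cs' <;> simp [diagPath]) h
      obtain ⟨rfl, h₂⟩ := key cs' (fun c hc => hg c (by simp [hc])) _ _ h₁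
      obtain ⟨rfl, rfl⟩ := ha a' (hg _ (by simp)) _ _ hr hr' h₂
      exact ⟨rfl, rfl⟩

theorem toPath_injOn : Set.InjOn toPath {t | t.Good} := fun t ht t' ht' h =>
  (toPath_append_inj t ht t' ht' [] [] (by simp) (by simp) (by rw [h])).1

/-- A word with at least as many rises as advances starts with the path of a tree, after which
it ends or makes a step other than `H`; with strictly more rises, it starts with the paths of
several trees separated by diagonal steps, followed by `V`. -/
theorem exists_toPath_append (n : ℕ) :
    (∀ p : List SStep, p.length ≤ n → pathX p ≤ pathY p →
      ∃ t : PTree, t.Good ∧ ∃ r, r.head? ≠ some .H ∧ p = t.toPath ++ r) ∧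
    (∀ p : List SStep, p.length ≤ n → pathX p < pathY p →
      ∃ b : PTree, b.Good ∧ ∃ cs : List PTree, (∀ c ∈ cs, c.Good) ∧
        ∃ r, p = b.toPath ++ (diagPath cs ++ .V :: r)) := by
  induction n with
  | zero =>
    refine ⟨fun p hp _ => ⟨node [], by simp [good_node], [], by simp, ?_⟩, fun p hp h => ?_⟩
    · simpa [toPath] using hp
    · simp_all [pathX, pathY]
  | succ n ih =>
    have htree : ∀ p : List SStep, p.length ≤ n + 1 → pathX p ≤ pathY p →
        ∃ t : PTree, t.Good ∧ ∃ r, r.head? ≠ some .H ∧ p = t.toPath ++ r := by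
      intro p hp h
      by_cases hH : p.head? = some .H
      · obtain ⟨p, rfl⟩ := List.head?_eq_some_iff.1 hH
        simp only [List.length_cons, pathX_cons, pathY_cons, SStep.dx, SStep.dy] at hp h
        obtain ⟨b, hb, cs, hcs, r, rfl⟩ := ih.2 p (by omega) (by omega)
        have hbal := pathX_toPath b hb
        have hbal' := pathX_diagPath cs hcs
        simp only [List.length_cons, List.length_append, pathX_append, pathY_append, pathX_cons,
          pathY_cons, SStep.dx, SStep.dy] at hp h
        obtain ⟨a, ha, r, hr, rfl⟩ := ih.1 r (by omega) (by omega)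
        refine ⟨node (a :: b :: cs), ?_, r, hr, by simp [toPath]⟩
        simpa [good_node] using ⟨ha, hb, hcs⟩
      · exact ⟨node [], by simp [good_node], p, hH, by simp [toPath]⟩
    refine ⟨htree, fun p hp h => ?_⟩
    obtain ⟨b, hb, r, hr, rfl⟩ := htree p hp h.le
    have hbal := pathX_toPath b hb
    rw [pathX_append, pathY_append] at h
    match r, hr with
    | [], _ => simp [pathX_nil, pathY_nil, hbal] at h
    | .H :: r, hr => simp at hr
    | .V :: r, _ => exact ⟨b, hb, [], by simp, r, by simp [diagPath]⟩
    | .D :: r, _ =>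
      simp only [List.length_cons, List.length_append, pathX_cons, pathY_cons, SStep.dx,
        SStep.dy] at hp h
      obtain ⟨c, hc, cs, hcs, r, rfl⟩ := ih.2 r (by omega) (by omega)
      exact ⟨b, hb, c :: cs, by simpa using ⟨hc, hcs⟩, r, by simp [diagPath]⟩

theorem exists_toPath_eq {n : ℕ} {p : List SStep} (hp : IsSchroder n p) (hd : DiagFree p) :
    ∃ t : PTree, t.Good ∧ t.toPath = p := by
  obtain ⟨t, ht, r, hr, rfl⟩ :=
    (exists_toPath_append p.length).1 p le_rfl (hp.1.trans hp.2.1.symm).le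
  refine ⟨t, ht, ?_⟩
  have hbal := pathX_toPath t ht
  match r, hr with
  | [], _ => simp
  | .H :: r, hr => simp at hr
  | .V :: r, _ =>
    have := hp.2.2 (t.toPath ++ [.V]) ⟨r, by simp⟩
    simp only [pathX_append, pathY_append, pathX_cons, pathY_cons, pathX_nil, pathY_nil,
      SStep.dx, SStep.dy] at this
    omega
  | .D :: r, _ => exact absurd hbal (hd _ r rfl)

end PTree

/-- For every n ≥ 1 and m ≥ 0 there is a bijection between PT(n,m)
and the Schröder paths of semilength n with n−m diagonal steps, none on the diagonal. -/
theorem statement0 (n m : ℕ) (hn : 1 ≤ n) : Nonempty (PT n m ≃ SPplus n m) := by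
  let f : PT n m → SPplus n m := fun t => ⟨t.1.toPath, by
    obtain ⟨t, ht, hl, hi⟩ := t
    have h := leaves_toPath t ht
    have hs := staysBelow_toPath t ht
    refine ⟨⟨by dsimp only; omega, by dsimp only; omega, fun q hq => ?_⟩, by dsimp only; omega,
      fun q r hq => ?_⟩
    · simpa using hs.pathY_le q hq
    · have := hs.pathY_lt q ⟨r, by simp [hq]⟩
      omega⟩
  refine ⟨Equiv.ofBijective f ⟨fun t t' h => ?_, fun ⟨p, hp, hc, hd⟩ => ?_⟩⟩
  · exact Subtype.ext (toPath_injOn t.2.1 t'.2.1 (congrArg Subtype.val h))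
  · obtain ⟨t, ht, rfl⟩ := exists_toPath_eq hp hd
    have h := leaves_toPath t ht
    have hx := hp.1
    exact ⟨⟨t, ht, by omega, by omega⟩, rfl⟩
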